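/- Let l > 0 be a real number and let f be a real polynomial in n variables nonnegative on the cube [−l,l]^n. Then for every ε > 0 there exists r(f,ε,l) ∈ ℕ such that for every r ≥ r(f,ε,l), the polynomial f + ε·(1 + Σ_{j=1}^n (X_j/l)^{2r}) is a sum of squares of polynomials. -/

import Mathlib

open MvPolynomial

/-- The sum of the absolute values of the coefficients of a polynomial. -/
noncomputable def coeffNorm {σ : Type*} (p : MvPolynomial σ ℝ) : ℝ :=
  ∑ m ∈ p.support, |coeff m p|

section coeffNorm

variable {σ : Type*}

lemma coeffNorm_eq_sum {p : MvPolynomial σ ℝ} {s : Finset (σ →₀ ℕ)} (h : p.support ⊆ s) :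
    coeffNorm p = ∑ m ∈ s, |coeff m p| :=
  Finset.sum_subset h fun m _ hm => by simp [notMem_support_iff.mp hm]

lemma coeffNorm_nonneg (p : MvPolynomial σ ℝ) : 0 ≤ coeffNorm p :=
  Finset.sum_nonneg fun _ _ => abs_nonneg _

lemma coeffNorm_zero : coeffNorm (0 : MvPolynomial σ ℝ) = 0 := by simp [coeffNorm]

lemma coeffNorm_neg (p : MvPolynomial σ ℝ) : coeffNorm (-p) = coeffNorm p := by
  simp [coeffNorm]

lemma coeffNorm_monomial (m : σ →₀ ℕ) (c : ℝ) : coeffNorm (monomial m c) = |c| := by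
  classical
  rw [coeffNorm_eq_sum (support_monomial_subset (s := m) (a := c))]
  simp

lemma coeffNorm_C (c : ℝ) : coeffNorm (C c : MvPolynomial σ ℝ) = |c| :=
  coeffNorm_monomial 0 c

lemma coeffNorm_add_le (p q : MvPolynomial σ ℝ) :
    coeffNorm (p + q) ≤ coeffNorm p + coeffNorm q := by
  classical
  rw [coeffNorm_eq_sum (p := p + q) (s := p.support ∪ q.support) support_add,
    coeffNorm_eq_sum (p := p) (s := p.support ∪ q.support) Finset.subset_union_left,
    coeffNorm_eq_sum (p := q) (s := p.support ∪ q.support) Finset.subset_union_right,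
    ← Finset.sum_add_distrib]
  exact Finset.sum_le_sum fun m _ => by rw [coeff_add]; exact abs_add_le _ _

lemma coeffNorm_sub_le (p q : MvPolynomial σ ℝ) :
    coeffNorm (p - q) ≤ coeffNorm p + coeffNorm q := by
  simpa [sub_eq_add_neg, coeffNorm_neg] using coeffNorm_add_le p (-q)

lemma coeffNorm_sum_le {ι : Type*} (s : Finset ι) (p : ι → MvPolynomial σ ℝ) :
    coeffNorm (∑ i ∈ s, p i) ≤ ∑ i ∈ s, coeffNorm (p i) :=
  Finset.le_sum_of_subadditive _ coeffNorm_zero.le coeffNorm_add_le s p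

lemma coeffNorm_mul_le (p q : MvPolynomial σ ℝ) :
    coeffNorm (p * q) ≤ coeffNorm p * coeffNorm q := by
  have h : p * q = ∑ a ∈ p.support, ∑ b ∈ q.support,
      monomial (a + b) (coeff a p * coeff b q) := by
    conv_lhs => rw [p.as_sum, q.as_sum, Finset.sum_mul_sum]
    simp only [monomial_mul]
  rw [h, coeffNorm.eq_def p, coeffNorm.eq_def q, Finset.sum_mul_sum]
  refine (coeffNorm_sum_le _ _).trans (Finset.sum_le_sum fun a _ => ?_)
  refine (coeffNorm_sum_le _ _).trans (Finset.sum_le_sum fun b _ => ?_)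
  rw [coeffNorm_monomial, abs_mul]

end coeffNorm

lemma IsSumSq.mvPolynomial_C {σ : Type*} {c : ℝ} (hc : 0 ≤ c) :
    IsSumSq (C c : MvPolynomial σ ℝ) := by
  have : (C c : MvPolynomial σ ℝ) = C √c * C √c := by
    rw [← C_mul, Real.mul_self_sqrt hc]
  rw [this]
  exact .mul_self _

/-- The closure of the sums of squares for the coefficient norm, a subsemiring. -/
def sumSqClosure (σ : Type*) : Subsemiring (MvPolynomial σ ℝ) where
  carrier := {f | ∀ δ : ℝ, 0 < δ → ∃ s, IsSumSq s ∧ coeffNorm (f - s) ≤ δ}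
  zero_mem' δ hδ := ⟨0, .zero, by simpa [coeffNorm_zero] using hδ.le⟩
  one_mem' δ hδ := ⟨1, .one,
    by simpa [coeffNorm_zero] using hδ.le⟩
  add_mem' {f g} hf hg δ hδ := by
    obtain ⟨s, hs, hs'⟩ := hf (δ / 2) (half_pos hδ)
    obtain ⟨t, ht, ht'⟩ := hg (δ / 2) (half_pos hδ)
    refine ⟨s + t, hs.add ht, ?_⟩
    rw [add_sub_add_comm]
    linarith [coeffNorm_add_le (f - s) (g - t)]
  mul_mem' {f g} hf hg δ hδ := by
    have hF := coeffNorm_nonneg f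
    have hG := coeffNorm_nonneg g
    have hpos : 0 < coeffNorm f + coeffNorm g + 1 := by positivity
    set η := min 1 (δ / (coeffNorm f + coeffNorm g + 1)) with hη
    have hη0 : 0 < η := lt_min one_pos (div_pos hδ hpos)
    have hη1 : η ≤ 1 := min_le_left _ _
    have hη2 : η * (coeffNorm f + coeffNorm g + 1) ≤ δ := by
      rw [← le_div_iff₀ hpos]; exact min_le_right _ _
    obtain ⟨s, hs, hs'⟩ := hf η hη0
    obtain ⟨t, ht, ht'⟩ := hg η hη0
    refine ⟨s * t, hs.mul ht, ?_⟩
    have key : f * g - s * t = f * (g - t) + (f - s) * g - (f - s) * (g - t) := by ring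
    have hs0 := coeffNorm_nonneg (f - s)
    have ht0 := coeffNorm_nonneg (g - t)
    calc coeffNorm (f * g - s * t)
        ≤ coeffNorm f * coeffNorm (g - t) + coeffNorm (f - s) * coeffNorm g
            + coeffNorm (f - s) * coeffNorm (g - t) := by
          rw [key]
          refine (coeffNorm_sub_le _ _).trans ?_
          gcongr
          · refine (coeffNorm_add_le _ _).trans ?_
            gcongr <;> exact coeffNorm_mul_le _ _
          · exact coeffNorm_mul_le _ _
      _ ≤ coeffNorm f * η + η * coeffNorm g + η * 1 := by
          gcongr
          exact ht'.trans hη1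
      _ ≤ δ := by linarith

lemma IsSumSq.mem_sumSqClosure {σ : Type*} {f : MvPolynomial σ ℝ} (hf : IsSumSq f) :
    f ∈ sumSqClosure σ := fun δ hδ => ⟨f, hf, by simpa [coeffNorm_zero] using hδ.le⟩

lemma mem_sumSqClosure_of_add_C {σ : Type*} {f : MvPolynomial σ ℝ}
    (h : ∀ δ : ℝ, 0 < δ → f + C δ ∈ sumSqClosure σ) : f ∈ sumSqClosure σ := by
  intro δ hδ
  obtain ⟨s, hs, hs'⟩ := h (δ / 2) (half_pos hδ) (δ / 2) (half_pos hδ)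
  refine ⟨s, hs, ?_⟩
  have := coeffNorm_sub_le (f + C (δ / 2) - s) (C (δ / 2))
  rw [coeffNorm_C, abs_of_pos (half_pos hδ)] at this
  rw [show f - s = f + C (δ / 2) - s - C (δ / 2) by ring]
  linarith

lemma one_sub_eq_sum_add {σ : Type*} (p : MvPolynomial σ ℝ) (K : ℕ) :
    1 - p = ∑ k ∈ Finset.range K,
        C ((1 / 2 : ℝ) ^ (k + 1)) * ((1 - p ^ 2 ^ k) * (1 - p ^ 2 ^ k)) +
      C ((1 / 2 : ℝ) ^ K) * (1 - p ^ 2 ^ K) := by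
  induction K with
  | zero => simp
  | succ K ih =>
    have h : (C ((1 / 2 : ℝ) ^ K) : MvPolynomial σ ℝ) = 2 * C ((1 / 2 : ℝ) ^ (K + 1)) := by
      rw [show (2 : MvPolynomial σ ℝ) = C 2 from (map_ofNat C 2).symm, ← C_mul]
      congr 1
      ring
    rw [Finset.sum_range_succ, ih, add_assoc, add_right_inj, h, pow_succ 2 K, pow_mul]
    ring

lemma one_sub_mem_sumSqClosure {σ : Type*} {p : MvPolynomial σ ℝ}
    (hp : ∀ k, coeffNorm (p ^ k) ≤ 1) : 1 - p ∈ sumSqClosure σ := by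
  intro δ hδ
  obtain ⟨K, hK⟩ := exists_pow_lt_of_lt_one (half_pos hδ) (by norm_num : (1 / 2 : ℝ) < 1)
  refine ⟨∑ k ∈ Finset.range K,
    C ((1 / 2 : ℝ) ^ (k + 1)) * ((1 - p ^ 2 ^ k) * (1 - p ^ 2 ^ k)),
    IsSumSq.sum fun k _ => (IsSumSq.mvPolynomial_C (by positivity)).mul (.mul_self _), ?_⟩
  rw [sub_eq_of_eq_add' (one_sub_eq_sum_add p K)]
  have h1 : coeffNorm (1 - p ^ 2 ^ K) ≤ 1 + 1 := by
    refine (coeffNorm_sub_le _ _).trans (add_le_add ?_ (hp _))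
    simpa using (coeffNorm_C (σ := σ) 1).le
  refine (coeffNorm_mul_le _ _).trans ?_
  rw [coeffNorm_C, abs_of_pos (by positivity)]
  nlinarith [pow_pos (by norm_num : (0 : ℝ) < 1 / 2) K]

lemma coeffNorm_C_mul_X_pow_le {σ : Type*} {c : ℝ} (hc : |c| ≤ 1) (i : σ) (k : ℕ) :
    coeffNorm ((C c * X i) ^ k) ≤ 1 := by
  rw [C_mul_X_eq_monomial, monomial_pow, coeffNorm_monomial, abs_pow]
  exact pow_le_one₀ (abs_nonneg _) hc

lemma IsSumSq.of_eq {A : Type*} [CommRing A] {a b : A} (ha : IsSumSq a) (h : b = a) :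
    IsSumSq b :=
  h ▸ ha

lemma isSumSq_sq_pow {A : Type*} [CommRing A] (a : A) (k : ℕ) : IsSumSq ((a ^ 2) ^ k) := by
  rw [← pow_mul, mul_comm, pow_mul, sq]
  exact .mul_self _

lemma isSumSq_sq_pow_add_sub_mul {A : Type*} [CommRing A] (a b : A) (k l : ℕ) :
    IsSumSq ((a ^ 2) ^ (k + l) + (b ^ 2) ^ (k + l) - (a ^ 2) ^ k * (b ^ 2) ^ l) := by
  have geom (n : ℕ) : ∃ s, IsSumSq s ∧ (a ^ 2) ^ n - (b ^ 2) ^ n = (a ^ 2 - b ^ 2) * s :=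
    ⟨_, IsSumSq.sum fun i _ => (isSumSq_sq_pow a i).mul (isSumSq_sq_pow b (n - 1 - i)),
      ((Commute.all _ _).mul_geom_sum₂ n).symm⟩
  obtain ⟨s, hs, hs'⟩ := geom k
  obtain ⟨t, ht, ht'⟩ := geom l
  have : (a ^ 2) ^ (k + l) + (b ^ 2) ^ (k + l) - (a ^ 2) ^ k * (b ^ 2) ^ l =
      (a ^ 2 - b ^ 2) * (a ^ 2 - b ^ 2) * (s * t) + (b ^ 2) ^ k * (a ^ 2) ^ l := by
    have := congrArg₂ (· * ·) hs' ht'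
    linear_combination this
  rw [this]
  exact ((IsSumSq.mul_self _).mul (hs.mul ht)).add ((isSumSq_sq_pow b k).mul (isSumSq_sq_pow a l))

lemma isSumSq_one_add_sq_pow_sub {A : Type*} [CommRing A] (a : A) {k r : ℕ} (h : k ≤ r) :
    IsSumSq (1 + (a ^ 2) ^ r - (a ^ 2) ^ k) := by
  obtain ⟨l, rfl⟩ := Nat.exists_eq_add_of_le h
  simpa [add_comm] using isSumSq_sq_pow_add_sub_mul a 1 k l

lemma exists_isSumSq_natCast_mul_sub_prod {A ι : Type*} [CommRing A] (x : ι → A) (s : Finset ι) :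
    ∃ N : ℕ, ∀ m : ι → ℕ, IsSumSq (N * (1 + ∑ i ∈ s, (x i ^ 2) ^ (∑ j ∈ s, m j)) -
      ∏ i ∈ s, (x i ^ 2) ^ m i) := by
  classical
  induction s using Finset.induction_on with
  | empty => exact ⟨1, fun m => by simp⟩
  | insert a s ha ih =>
    obtain ⟨N, hN⟩ := ih
    refine ⟨N * (s.card + 1), fun m => ?_⟩
    have h1 := (isSumSq_sq_pow (x a) (m a)).mul (hN m)
    have h2 := isSumSq_one_add_sq_pow_sub (x a) (Nat.le_add_right (m a) (∑ j ∈ s, m j))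
    have h3 : IsSumSq (∑ i ∈ s, ((x a ^ 2) ^ (m a + ∑ j ∈ s, m j) +
        (x i ^ 2) ^ (m a + ∑ j ∈ s, m j) - (x a ^ 2) ^ m a * (x i ^ 2) ^ ∑ j ∈ s, m j)) :=
      IsSumSq.sum fun _ _ => isSumSq_sq_pow_add_sub_mul _ _ _ _
    have h4 : IsSumSq (s.card * (1 + ∑ i ∈ s, (x i ^ 2) ^ (m a + ∑ j ∈ s, m j))) :=
      (IsSumSq.natCast _).mul (.add .one (.sum fun i _ => isSumSq_sq_pow _ _))
    have h5 := h1.add ((IsSumSq.natCast N).mul ((h2.add h3).add h4))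
    refine h5.of_eq ?_
    simp only [Finset.sum_insert ha, Finset.prod_insert ha, Finset.sum_sub_distrib,
      Finset.sum_add_distrib, Finset.sum_const, ← Finset.mul_sum, nsmul_eq_mul]
    push_cast
    ring

lemma exists_isSumSq_natCast_mul_sub_prod_of_sum_le {A ι : Type*} [CommRing A] [Fintype ι]
    (x : ι → A) : ∃ N : ℕ, ∀ (m : ι → ℕ) (r : ℕ), ∑ i, m i ≤ r →
      IsSumSq (N * (1 + ∑ i, (x i ^ 2) ^ r) - ∏ i, (x i ^ 2) ^ m i) := by
  obtain ⟨N, hN⟩ := exists_isSumSq_natCast_mul_sub_prod x Finset.univ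
  refine ⟨N * (Fintype.card ι + 1), fun m r hr => ?_⟩
  have h1 : IsSumSq (∑ i, (1 + (x i ^ 2) ^ r - (x i ^ 2) ^ ∑ i, m i)) :=
    IsSumSq.sum fun i _ => isSumSq_one_add_sq_pow_sub _ hr
  have h2 : IsSumSq (Fintype.card ι * ∑ i, (x i ^ 2) ^ r) :=
    (IsSumSq.natCast _).mul (.sum fun i _ => isSumSq_sq_pow _ _)
  refine ((hN m).add ((IsSumSq.natCast N).mul (h1.add h2))).of_eq ?_
  simp only [Finset.sum_sub_distrib, Finset.sum_add_distrib, Finset.sum_const, nsmul_eq_mul,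
    Finset.card_univ]
  push_cast
  ring

lemma isSumSq_one_add_sum_pow {A ι : Type*} [CommRing A] [Fintype ι] (x : ι → A) (r : ℕ) :
    IsSumSq (1 + ∑ i, (x i ^ 2) ^ r) :=
  .add .one (.sum fun _ _ => isSumSq_sq_pow _ _)

/-- A polynomial is dominated by its coefficient norm times `1 + ∑ X_i ^ (2r)`, up to a factor
depending only on the variables. -/
lemma exists_isSumSq_add_coeffNorm_mul (σ : Type*) [Fintype σ] :
    ∃ N : ℕ, ∀ (p : MvPolynomial σ ℝ) (r : ℕ), p.totalDegree ≤ r →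
      IsSumSq (p + C (coeffNorm p) * ((N : MvPolynomial σ ℝ) * (1 + ∑ i, (X i ^ 2) ^ r))) := by
  obtain ⟨N, hN⟩ := exists_isSumSq_natCast_mul_sub_prod_of_sum_le
    (X : σ → MvPolynomial σ ℝ)
  refine ⟨N + 1, fun p r hr => ?_⟩
  have key : ∀ m ∈ p.support, IsSumSq (monomial m (coeff m p) +
      C |coeff m p| * (((N + 1 : ℕ) : MvPolynomial σ ℝ) * (1 + ∑ i, (X i ^ 2) ^ r))) := by
    intro m hm
    have hdeg : ∑ i, m i ≤ r := by
      refine le_trans ?_ ((le_totalDegree hm).trans hr)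
      rw [Finsupp.sum_fintype _ _ fun _ => rfl]
    set q : MvPolynomial σ ℝ := ∏ i, X i ^ m i with hq
    have hmon : monomial m (coeff m p) = C (coeff m p) * q := by
      rw [monomial_eq, Finsupp.prod_fintype _ _ fun _ => pow_zero _]
    have h1 : IsSumSq ((N : MvPolynomial σ ℝ) * (1 + ∑ i, (X i ^ 2) ^ r) - q * q) := by
      refine (hN m r hdeg).of_eq ?_
      rw [hq, ← Finset.prod_mul_distrib, sub_right_inj]
      exact Finset.prod_congr rfl fun _ _ => by ring
    have h2 : IsSumSq (∑ i, ((X i : MvPolynomial σ ℝ) ^ 2) ^ r) :=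
      .sum fun i _ => isSumSq_sq_pow _ _
    have hhalf : (C (1 / 2 : ℝ) : MvPolynomial σ ℝ) * 2 = 1 := by
      rw [show (2 : MvPolynomial σ ℝ) = C 2 from (map_ofNat C 2).symm, ← C_mul]
      norm_num
    have hC : IsSumSq (C (1 / 2 : ℝ) : MvPolynomial σ ℝ) := .mvPolynomial_C (by norm_num)
    have h3 (e : MvPolynomial σ ℝ) (he : e * e = 1) :
        IsSumSq (e * q + ((N : MvPolynomial σ ℝ) + 1) * (1 + ∑ i, (X i ^ 2) ^ r)) := by
      refine (((h1.add h2).add (hC.mul (.mul_self (1 + e * q)))).add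
        (hC.mul (IsSumSq.one.add (.mul_self q)))).of_eq ?_
      linear_combination (-(1 + e * q + q * q)) * hhalf - C (1 / 2 : ℝ) * q * q * he
    have h4 : IsSumSq (C |coeff m p| : MvPolynomial σ ℝ) := .mvPolynomial_C (abs_nonneg _)
    rw [hmon]
    push_cast
    rcases abs_choice (coeff m p) with h | h
    · refine (h4.mul (h3 1 (by ring))).of_eq ?_
      rw [h]; ring
    · refine (h4.mul (h3 (-1) (by ring))).of_eq ?_
      rw [h, C_neg]; ring
  refine (IsSumSq.sum key).of_eq ?_
  rw [Finset.sum_add_distrib, support_sum_monomial_coeff, ← Finset.sum_mul, coeffNorm, map_sum]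

open Filter Topology in
/-- On the filter of pairs `(m, J)` with `m → ∞` and `J ≤ m`, the ratio of binomial coefficients
`(J_i choose k) / (m choose k)` is asymptotic to `(J_i / m) ^ k`. -/
lemma tendsto_choose_div_choose_sub_pow {ι : Type*} (i : ι) (k : ℕ) :
    Tendsto (fun z : ℕ × (ι → ℕ) =>
        ((z.2 i).choose k : ℝ) / (z.1.choose k : ℝ) - ((z.2 i : ℝ) / z.1) ^ k)
      (Filter.comap Prod.fst atTop ⊓ 𝓟 {z | ∀ i, z.2 i ≤ z.1}) (𝓝 0) := by
  set F := Filter.comap Prod.fst atTop ⊓ 𝓟 {z : ℕ × (ι → ℕ) | ∀ i, z.2 i ≤ z.1} with hF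
  have hfst : Tendsto (fun z : ℕ × (ι → ℕ) => z.1) F atTop :=
    tendsto_comap.mono_left inf_le_left
  have hle : ∀ᶠ z in F, ∀ i, z.2 i ≤ z.1 :=
    eventually_of_mem (mem_inf_of_right (mem_principal_self _)) fun z hz => hz
  induction k with
  | zero => simpa using tendsto_const_nhds
  | succ k ih =>
    have hk : Tendsto (fun z : ℕ × (ι → ℕ) => |((z.2 i).choose k : ℝ) / (z.1.choose k : ℝ)
        - ((z.2 i : ℝ) / z.1) ^ k| + k / ((z.1 : ℝ) - k)) F (𝓝 0) := by
      have h2 : Tendsto (fun z : ℕ × (ι → ℕ) => (k : ℝ) / ((z.1 : ℝ) - k)) F (𝓝 0) :=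
        Tendsto.div_atTop tendsto_const_nhds
          ((tendsto_atTop_add_const_right _ (-(k : ℝ)) tendsto_natCast_atTop_atTop).comp hfst)
      simpa using ih.abs.add h2
    refine squeeze_zero_norm' ?_ hk
    filter_upwards [hle, hfst.eventually_gt_atTop k] with z hz hzk
    obtain ⟨m, J⟩ := z
    simp only at hz hzk ⊢
    replace hz := hz i
    generalize J i = j at hz ⊢
    have hm : (0 : ℝ) < m := by exact_mod_cast (Nat.zero_le k).trans_lt hzk
    have hmk : (0 : ℝ) < m - k := sub_pos.mpr (by exact_mod_cast hzk)
    have hcm : (0 : ℝ) < m.choose k := by exact_mod_cast Nat.choose_pos hzk.le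
    have hjm : (j : ℝ) ≤ m := by exact_mod_cast hz
    have hch : (j.choose k : ℝ) ≤ m.choose k := by exact_mod_cast Nat.choose_le_choose k hz
    have succ (a : ℕ) : (a.choose (k + 1) : ℝ) * (k + 1) = a.choose k * (a - k) := by
      rcases le_or_gt k a with h | h
      · have := Nat.choose_succ_right_eq a k
        rw [← Nat.cast_sub h]
        exact_mod_cast this
      · simp [Nat.choose_eq_zero_of_lt h, Nat.choose_eq_zero_of_lt (h.trans (Nat.lt_succ_self k))]
    have hcm' : (0 : ℝ) < m.choose (k + 1) := by exact_mod_cast Nat.choose_pos hzk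
    have hw : (j.choose (k + 1) : ℝ) / m.choose (k + 1) =
        j.choose k / m.choose k * ((j - k) / (m - k)) := by
      rw [div_mul_div_comm, div_eq_div_iff hcm'.ne' (mul_pos hcm hmk).ne', ← succ, ← succ]
      ring
    set w := (j.choose k : ℝ) / m.choose k with hwdef
    have hw0 : 0 ≤ w := by positivity
    have hw1 : w ≤ 1 := (div_le_one hcm).mpr hch
    have ht0 : 0 ≤ (j : ℝ) / m := by positivity
    have ht1 : (j : ℝ) / m ≤ 1 := (div_le_one hm).mpr hjm
    have hd : |((j : ℝ) - k) / (m - k) - j / m| ≤ k / (m - k) := by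
      have : ((j : ℝ) - k) / (m - k) - j / m = -(k / (m - k) * (1 - j / m)) := by
        field_simp
        ring
      rw [this, abs_neg, abs_of_nonneg (mul_nonneg (by positivity) (by linarith))]
      exact mul_le_of_le_one_right (by positivity) (by linarith)
    rw [hw, Real.norm_eq_abs]
    have : w * (((j : ℝ) - k) / (m - k)) - (j / m : ℝ) ^ (k + 1) =
        (w - (j / m : ℝ) ^ k) * (j / m) + w * (((j : ℝ) - k) / (m - k) - j / m) := by ring
    rw [this]
    refine (abs_add_le _ _).trans (add_le_add ?_ ?_)
    · rw [abs_mul, abs_of_nonneg ht0]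
      exact mul_le_of_le_one_right (abs_nonneg _) ht1
    · rw [abs_mul, abs_of_nonneg hw0]
      exact (mul_le_of_le_one_left (abs_nonneg _) hw1).trans hd

open Filter Topology in
lemma tendsto_prod_sub_prod {α ι : Type*} {F : Filter α} (s : Finset ι) (a b : ι → α → ℝ)
    (ha : ∀ᶠ z in F, ∀ i, |a i z| ≤ 1) (hb : ∀ᶠ z in F, ∀ i, |b i z| ≤ 1)
    (hab : ∀ i, Tendsto (fun z => a i z - b i z) F (𝓝 0)) :
    Tendsto (fun z => ∏ i ∈ s, a i z - ∏ i ∈ s, b i z) F (𝓝 0) := by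
  classical
  induction s using Finset.induction_on with
  | empty => simpa using tendsto_const_nhds
  | insert j s hj ih =>
    refine squeeze_zero_norm' ?_ (by simpa using (hab j).abs.add ih.abs)
    filter_upwards [ha, hb] with z haz hbz
    rw [Finset.prod_insert hj, Finset.prod_insert hj, Real.norm_eq_abs]
    have : a j z * ∏ i ∈ s, a i z - b j z * ∏ i ∈ s, b i z =
      (a j z - b j z) * ∏ i ∈ s, a i z + b j z * (∏ i ∈ s, a i z - ∏ i ∈ s, b i z) := by ring
    rw [this]
    refine (abs_add_le _ _).trans (add_le_add ?_ ?_)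
    · rw [abs_mul, Finset.abs_prod]
      exact mul_le_of_le_one_right (abs_nonneg _)
        (Finset.prod_le_one (fun _ _ => abs_nonneg _) fun i _ => haz i)
    · rw [abs_mul]
      exact mul_le_of_le_one_left (abs_nonneg _) (hbz j)

open Filter Topology in
/-- The Bernstein coefficients of a polynomial nonnegative on the unit cube are eventually
bounded below by any negative number. -/
lemma exists_forall_le_sum_coeff_mul_prod {ι : Type*} [Fintype ι] (h : MvPolynomial ι ℝ)
    (hh : ∀ x : ι → ℝ, (∀ i, x i ∈ Set.Icc (0 : ℝ) 1) → 0 ≤ eval x h) {δ : ℝ} (hδ : 0 < δ) :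
    ∃ M : ℕ, ∀ m ≥ M, ∀ J : ι → ℕ, (∀ i, J i ≤ m) →
      -δ ≤ ∑ α ∈ h.support, coeff α h *
        ∏ i, (((J i).choose (α i) : ℝ) / (m.choose (α i) : ℝ)) := by
  set F := Filter.comap Prod.fst atTop ⊓ 𝓟 {z : ℕ × (ι → ℕ) | ∀ i, z.2 i ≤ z.1} with hF
  have hle : ∀ᶠ z in F, ∀ i, z.2 i ≤ z.1 :=
    eventually_of_mem (mem_inf_of_right (mem_principal_self _)) fun z hz => hz
  have key : Tendsto (fun z : ℕ × (ι → ℕ) => ∑ α ∈ h.support, coeff α h *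
      (∏ i, (((z.2 i).choose (α i) : ℝ) / (z.1.choose (α i) : ℝ)) -
        ∏ i, ((z.2 i : ℝ) / z.1) ^ α i)) F (𝓝 0) := by
    rw [show (0 : ℝ) = ∑ α ∈ h.support, coeff α h * 0 by simp]
    refine tendsto_finsetSum _ fun α _ => Tendsto.const_mul _ ?_
    refine tendsto_prod_sub_prod Finset.univ _ _ ?_ ?_ fun i =>
      tendsto_choose_div_choose_sub_pow i (α i)
    · filter_upwards [hle] with z hz i
      rw [abs_of_nonneg (by positivity)]
      exact div_le_one_of_le₀ (by exact_mod_cast Nat.choose_le_choose _ (hz i)) (by positivity)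
    · filter_upwards [hle] with z hz i
      rw [abs_of_nonneg (by positivity)]
      exact pow_le_one₀ (by positivity)
        (div_le_one_of_le₀ (by exact_mod_cast hz i) (by positivity))
  have ev := key.eventually (lt_mem_nhds (neg_lt_zero.mpr hδ))
  rw [hF, eventually_inf_principal, eventually_comap, eventually_atTop] at ev
  obtain ⟨M, hM⟩ := ev
  refine ⟨M, fun m hm J hJ => ?_⟩
  have h1 := hM m hm (m, J) rfl hJ
  have h2 := hh (fun i => (J i : ℝ) / m) fun i =>
    ⟨by positivity, div_le_one_of_le₀ (by exact_mod_cast hJ i) (by positivity)⟩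
  rw [eval_eq'] at h2
  simp only [mul_sub, Finset.sum_sub_distrib] at h1
  linarith

lemma pow_eq_sum_choose_div_choose {A : Type*} [CommRing A] [Algebra ℝ A] (y : A) {k m : ℕ}
    (hk : k ≤ m) : y ^ k = ∑ j ∈ Finset.range (m + 1),
      algebraMap ℝ A ((j.choose k : ℝ) / m.choose k) *
        (algebraMap ℝ A (m.choose j) * (y ^ j * (1 - y) ^ (m - j))) := by
  have hpow : y ^ k = y ^ k * (y + (1 - y)) ^ (m - k) := by simp
  have hm : m + 1 = k + (m - k + 1) := by omega
  rw [hm, Finset.sum_range_add, Finset.sum_eq_zero, zero_add, hpow, add_pow, Finset.mul_sum]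
  · refine Finset.sum_congr rfl fun i hi => ?_
    have hi' : i ≤ m - k := Nat.lt_succ_iff.mp (Finset.mem_range.mp hi)
    have hc : (m.choose k : ℝ) ≠ 0 := by exact_mod_cast (Nat.choose_pos hk).ne'
    have hch : ((k + i).choose k : ℝ) / m.choose k * m.choose (k + i) = (m - k).choose i := by
      have := Nat.choose_mul (n := m) (k := k + i) (s := k) (by omega)
      rw [Nat.add_sub_cancel_left] at this
      rw [div_mul_eq_mul_div, div_eq_iff hc]
      norm_cast
      linarith
    rw [← mul_assoc (algebraMap ℝ A _), ← map_mul, hch, map_natCast, ← Nat.sub_sub, pow_add]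
    ring
  · intro j hj
    simp [Nat.choose_eq_zero_of_lt (Finset.mem_range.mp hj)]

/-- If a subsemiring contains the nonnegative constants, all `y i` and all `1 - y i`, then it
contains `h(y) + δ` for every `δ > 0` and every `h` nonnegative on the unit cube. -/
lemma aeval_add_algebraMap_mem {A ι : Type*} [CommRing A] [Algebra ℝ A] [Fintype ι]
    (T : Subsemiring A) (hT : ∀ c : ℝ, 0 ≤ c → algebraMap ℝ A c ∈ T) (y : ι → A)
    (hy : ∀ i, y i ∈ T) (hy' : ∀ i, 1 - y i ∈ T) (h : MvPolynomial ι ℝ)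
    (hh : ∀ x : ι → ℝ, (∀ i, x i ∈ Set.Icc (0 : ℝ) 1) → 0 ≤ eval x h) {δ : ℝ} (hδ : 0 < δ) :
    aeval y h + algebraMap ℝ A δ ∈ T := by
  classical
  obtain ⟨M, hM⟩ := exists_forall_le_sum_coeff_mul_prod h hh hδ
  set m := max M h.totalDegree
  set b : ℕ → A → A := fun j a => algebraMap ℝ A (m.choose j) * (a ^ j * (1 - a) ^ (m - j))
    with hb
  set P := Fintype.piFinset fun _ : ι => Finset.range (m + 1) with hP
  have hpow (α : ι → ℕ) (hα : ∀ i, α i ≤ m) : ∏ i, y i ^ α i = ∑ J ∈ P,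
      algebraMap ℝ A (∏ i, (((J i).choose (α i) : ℝ) / (m.choose (α i) : ℝ))) *
        ∏ i, b (J i) (y i) := by
    rw [Finset.prod_congr rfl fun i _ => pow_eq_sum_choose_div_choose (y i) (hα i),
      Finset.prod_univ_sum]
    refine Finset.sum_congr rfl fun J _ => ?_
    rw [map_prod, ← Finset.prod_mul_distrib]
  have hone : (1 : A) = ∑ J ∈ P, ∏ i, b (J i) (y i) := by
    simpa using hpow 0 fun i => Nat.zero_le _
  have hsum : aeval y h + algebraMap ℝ A δ = ∑ J ∈ P, algebraMap ℝ A
      (∑ α ∈ h.support, coeff α h *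
        ∏ i, (((J i).choose (α i) : ℝ) / (m.choose (α i) : ℝ)) + δ) * ∏ i, b (J i) (y i) := by
    simp only [map_add, add_mul, Finset.sum_add_distrib, ← Finset.mul_sum]
    rw [← hone, mul_one, add_left_inj]
    simp only [map_sum, map_mul, Finset.sum_mul]
    rw [Finset.sum_comm, aeval_def, eval₂_eq']
    refine Finset.sum_congr rfl fun α hα => ?_
    rw [hpow α fun i => ?_, Finset.mul_sum]
    · simp only [mul_assoc]
    · refine le_trans ?_ ((le_totalDegree hα).trans (le_max_right M _))
      rw [Finsupp.sum_fintype _ _ fun _ => rfl]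
      exact Finset.single_le_sum (fun _ _ => Nat.zero_le _) (Finset.mem_univ i)
  rw [hsum]
  refine T.sum_mem fun J hJ => T.mul_mem (hT _ ?_) (T.prod_mem fun i _ => ?_)
  · have hJ' : ∀ i, J i ≤ m := fun i =>
      Nat.lt_succ_iff.mp (Finset.mem_range.mp (Fintype.mem_piFinset.mp hJ i))
    linarith [hM m (le_max_left _ _) J hJ']
  · exact T.mul_mem (hT _ (by positivity)) (T.mul_mem (T.pow_mem (hy i) _) (T.pow_mem (hy' i) _))

lemma IsSumSq.map_ringHom {R S : Type*} [CommRing R] [CommRing S] (φ : R →+* S) {a : R}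
    (ha : IsSumSq a) : IsSumSq (φ a) := by
  induction ha with
  | zero => simp
  | sq_add b _ ih => rw [map_add, map_mul]; exact .sq_add _ ih

lemma mem_sumSqClosure_of_nonneg {σ : Type*} [Fintype σ] (g : MvPolynomial σ ℝ)
    (hg : ∀ x : σ → ℝ, (∀ i, |x i| ≤ 1) → 0 ≤ eval x g) : g ∈ sumSqClosure σ := by
  have hC (c : ℝ) (hc : 0 ≤ c) : C c ∈ sumSqClosure σ :=
    (IsSumSq.mvPolynomial_C hc).mem_sumSqClosure
  have hX (c : ℝ) (hc : |c| ≤ 1) (i : σ) : C (1 / 2) * (1 - C c * X i) ∈ sumSqClosure σ :=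
    mul_mem (hC _ (by norm_num)) (one_sub_mem_sumSqClosure (coeffNorm_C_mul_X_pow_le hc i))
  have htwo : (C (1 / 2 : ℝ) : MvPolynomial σ ℝ) * 2 = 1 := by
    rw [show (2 : MvPolynomial σ ℝ) = C 2 from (map_ofNat C 2).symm, ← C_mul]
    norm_num
  refine mem_sumSqClosure_of_add_C fun δ hδ => ?_
  convert aeval_add_algebraMap_mem (sumSqClosure σ) hC
    (fun i => C (1 / 2) * (1 - C (-1) * X i)) (fun i => hX (-1) (by simp) i) ?_
    (aeval (fun i => 2 * X i - 1) g) ?_ hδ using 2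
  · rw [← AlgHom.comp_apply, comp_aeval]
    conv_lhs => rw [← aeval_X_left_apply g]
    congr 2
    ext1 i
    simp only [map_sub, map_mul, map_ofNat, aeval_X, map_one, C_neg]
    linear_combination (-(1 + X i)) * htwo
  · rfl
  · intro i
    convert hX 1 (by simp) i using 1
    simp only [C_neg, C_1]
    linear_combination -htwo
  · intro x hx
    have := hg (fun i => 2 * x i - 1) fun i => by
      rw [abs_le]; constructor <;> linarith [(hx i).1, (hx i).2]
    convert this using 1
    rw [← coe_aeval_eq_eval, ← coe_aeval_eq_eval]
    simp only [RingHom.coe_coe]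
    rw [← AlgHom.comp_apply, comp_aeval]
    simp

lemma exists_forall_isSumSq_add_of_mem_sumSqClosure {σ : Type*} [Fintype σ]
    {g : MvPolynomial σ ℝ} (hg : g ∈ sumSqClosure σ) {ε : ℝ} (hε : 0 < ε) :
    ∃ r₀ : ℕ, ∀ r ≥ r₀, IsSumSq (g + C ε * (1 + ∑ i, X i ^ (2 * r))) := by
  obtain ⟨N, hN⟩ := exists_isSumSq_add_coeffNorm_mul σ
  obtain ⟨s, hs, hs'⟩ := hg (ε / (N + 1)) (by positivity)
  refine ⟨(g - s).totalDegree, fun r hr => ?_⟩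
  have hle : coeffNorm (g - s) * N ≤ ε := by
    rw [le_div_iff₀ (by positivity)] at hs'
    linarith [coeffNorm_nonneg (g - s)]
  have h := (hs.add (hN (g - s) r hr)).add
    ((IsSumSq.mvPolynomial_C (sub_nonneg.mpr hle)).mul (isSumSq_one_add_sum_pow X r))
  refine h.of_eq ?_
  simp only [pow_mul, C_sub, C_mul, map_natCast]
  ring

/-- If `f` is nonnegative on `[-l,l]^n` with `l > 0`, then for each `ε > 0` there is
`r(f,ε,l)` such that `f + ε (1 + ∑_j (X_j/l)^{2r})` is a sum of squares for all
`r ≥ r(f,ε,l)`. -/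
theorem stmt_6 (n : ℕ) (l : ℝ) (hl : 0 < l) (f : MvPolynomial (Fin n) ℝ)
    (hf : ∀ x : Fin n → ℝ, (∀ i, |x i| ≤ l) → 0 ≤ eval x f)
    (ε : ℝ) (hε : 0 < ε) :
    ∃ r0 : ℕ, ∀ r : ℕ, r0 ≤ r →
      IsSumSq (f + C ε * (1 + ∑ j : Fin n, (C l⁻¹ * X j) ^ (2 * r))) := by
  have hg : aeval (fun i => C l * X i) f ∈ sumSqClosure (Fin n) := by
    refine mem_sumSqClosure_of_nonneg _ fun x hx => ?_
    have := hf (fun i => l * x i) fun i => by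
      rw [abs_mul, abs_of_pos hl]
      exact mul_le_of_le_one_right hl.le (hx i)
    convert this using 1
    rw [← coe_aeval_eq_eval, ← coe_aeval_eq_eval]
    simp only [RingHom.coe_coe]
    rw [← AlgHom.comp_apply, comp_aeval]
    simp
  obtain ⟨r₀, hr₀⟩ := exists_forall_isSumSq_add_of_mem_sumSqClosure hg hε
  refine ⟨r₀, fun r hr => ?_⟩
  have h := (hr₀ r hr).map_ringHom
    (aeval (R := ℝ) fun i => C l⁻¹ * (X i : MvPolynomial (Fin n) ℝ)).toRingHom
  refine h.of_eq ?_
  simp only [AlgHom.toRingHom_eq_coe, RingHom.coe_coe, map_add, map_mul, map_sum, map_pow,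
    map_one, aeval_X, algHom_C, algebraMap_eq]
  congr 1
  rw [← AlgHom.comp_apply, comp_aeval]
  conv_lhs => rw [← aeval_X_left_apply f]
  congr 2
  ext1 i
  simp only [map_mul, algHom_C, aeval_X, algebraMap_eq]
  rw [← mul_assoc, ← C_mul, mul_inv_cancel₀ hl.ne', C_1, one_mul]
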